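/- Let d ≥ 1, let h : ℝ^d → ℝ be smooth and ℤ^d-periodic, let Ω = {(x,y) ∈ ℝ^d × ℝ : y < h(x)}, and let φ : closure(Ω) → ℝ be smooth, ℤ^d-periodic in x, harmonic in Ω (Δ_{x,y} φ = 0), with boundary value φ(x,h(x)) = h(x) for all x, such that every partial derivative ∂_x^α ∂_y^β φ of positive order converges to 0 uniformly in x as y → −∞. Set Q(x,y) = φ(x,y) − y and define the Taylor coefficient a(x) = −∂_y Q(x,h(x)). Then: (i) a(x) > 0 for every x ∈ ℝ^d; (ii) ∂_y Q(x,y) < 0 for all (x,y) ∈ closure(Ω); and (iii) inf_{closure(Ω)} (−∂_y Q) ≥ min{ inf_{x} a(x), 1 }. -/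

import Mathlib

open MeasureTheory Real

/-- Horizontal partial derivative `∂ᵢ f` of a function on `ℝᵈ`. -/
noncomputable def pder {d : ℕ} (i : Fin d) (f : EuclideanSpace ℝ (Fin d) → ℝ)
    (x : EuclideanSpace ℝ (Fin d)) : ℝ :=
  fderiv ℝ f x (EuclideanSpace.single i 1)

/-- Horizontal partial derivative `∂_{xᵢ} f` of a function on `ℝᵈ × ℝ`. -/
noncomputable def pdx {d : ℕ} (i : Fin d) (f : EuclideanSpace ℝ (Fin d) × ℝ → ℝ)
    (p : EuclideanSpace ℝ (Fin d) × ℝ) : ℝ :=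
  fderiv ℝ f p (EuclideanSpace.single i 1, 0)

/-- Vertical partial derivative `∂_y f` of a function on `ℝᵈ × ℝ`. -/
noncomputable def pdy {d : ℕ} (f : EuclideanSpace ℝ (Fin d) × ℝ → ℝ)
    (p : EuclideanSpace ℝ (Fin d) × ℝ) : ℝ :=
  fderiv ℝ f p (0, 1)

/-- The fundamental domain `[0,1)^d` of the torus `𝕋^d`. -/
def fundDom (d : ℕ) : Set (EuclideanSpace ℝ (Fin d)) :=
  {x | ∀ i, 0 ≤ x i ∧ x i < 1}

/-- `ℤ^d`-periodicity of a function on `ℝ^d`. -/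
def ZPeriodic {d : ℕ} (f : EuclideanSpace ℝ (Fin d) → ℝ) : Prop :=
  ∀ (x : EuclideanSpace ℝ (Fin d)) (k : Fin d → ℤ),
    f (x + (WithLp.equiv 2 (Fin d → ℝ)).symm (fun i => (k i : ℝ))) = f x

/-- `ℤ^d`-periodicity in the horizontal variable of a function on `ℝᵈ × ℝ`. -/
def ZPeriodicX {d : ℕ} (f : EuclideanSpace ℝ (Fin d) × ℝ → ℝ) : Prop :=
  ∀ (x : EuclideanSpace ℝ (Fin d)) (y : ℝ) (k : Fin d → ℤ),
    f (x + (WithLp.equiv 2 (Fin d → ℝ)).symm (fun i => (k i : ℝ)), y) = f (x, y)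

/-- Squared norm of the full gradient `|∇_{x,y} f|²` on `ℝᵈ × ℝ`. -/
noncomputable def fullGradSq {d : ℕ} (f : EuclideanSpace ℝ (Fin d) × ℝ → ℝ)
    (p : EuclideanSpace ℝ (Fin d) × ℝ) : ℝ :=
  (∑ i, (pdx i f p) ^ 2) + (pdy f p) ^ 2

/-- The pressure `Q(x,y) = φ(x,y) − y` associated with the harmonic extension `φ`. -/
noncomputable def pressure {d : ℕ} (φ : EuclideanSpace ℝ (Fin d) × ℝ → ℝ)
    (p : EuclideanSpace ℝ (Fin d) × ℝ) : ℝ :=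
  φ p - p.2

section helpers
open scoped ContDiff Topology

noncomputable def DD {V : Type*} [NormedAddCommGroup V] [NormedSpace ℝ V] (v : V) (f : V → ℝ) : V → ℝ :=
  fun p => fderiv ℝ f p v

variable {V : Type*} [NormedAddCommGroup V] [NormedSpace ℝ V]

lemma DD_smooth (v : V) {f : V → ℝ} (hf : ContDiff ℝ ∞ f) : ContDiff ℝ ∞ (DD v f) := by
  unfold DD
  exact (hf.fderiv_right (m := ∞) (by simp)).clm_apply contDiff_const

lemma smooth_diff {f : V → ℝ} (hf : ContDiff ℝ ∞ f) : Differentiable ℝ f :=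
  hf.differentiable (by simp)

lemma DD_add (v : V) {f g : V → ℝ} (hf : ContDiff ℝ ∞ f) (hg : ContDiff ℝ ∞ g) :
    DD v (fun p => f p + g p) = fun p => DD v f p + DD v g p := by
  funext p
  simp only [DD]
  rw [fderiv_fun_add (smooth_diff hf p) (smooth_diff hg p)]; rfl

lemma DD_sub (v : V) {f g : V → ℝ} (hf : ContDiff ℝ ∞ f) (hg : ContDiff ℝ ∞ g) :
    DD v (fun p => f p - g p) = fun p => DD v f p - DD v g p := by
  funext p
  simp only [DD]
  rw [fderiv_fun_sub (smooth_diff hf p) (smooth_diff hg p)]; rfl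

lemma DD_cmul (v : V) {f : V → ℝ} (c : ℝ) (hf : ContDiff ℝ ∞ f) :
    DD v (fun p => c * f p) = fun p => c * DD v f p := by
  funext p
  simp only [DD]
  rw [fderiv_const_mul (smooth_diff hf p)]; rfl

lemma DD_mul (v : V) {f g : V → ℝ} (hf : ContDiff ℝ ∞ f) (hg : ContDiff ℝ ∞ g) :
    DD v (fun p => f p * g p) = fun p => f p * DD v g p + g p * DD v f p := by
  funext p
  simp only [DD]
  rw [fderiv_fun_mul (smooth_diff hf p) (smooth_diff hg p)]; rfl

lemma DD_const (v : V) (c : ℝ) : DD v (fun _ => c) = fun _ => 0 := by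
  funext p; simp [DD]

lemma DD_exp (v : V) {f : V → ℝ} (hf : ContDiff ℝ ∞ f) :
    DD v (fun p => Real.exp (f p)) = fun p => Real.exp (f p) * DD v f p := by
  funext p
  simp only [DD]
  rw [fderiv_exp (smooth_diff hf p)]; rfl

lemma DD_comm (v w : V) {f : V → ℝ} (hf : ContDiff ℝ ∞ f) :
    DD v (DD w f) = DD w (DD v f) := by
  funext p
  have hd : DifferentiableAt ℝ (fderiv ℝ f) p :=
    ((hf.fderiv_right (m := ∞) (by simp)).differentiable (by simp)) p
  have key : ∀ a b : V, DD a (DD b f) p = fderiv ℝ (fderiv ℝ f) p a b := by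
    intro a b
    change fderiv ℝ (fun q => fderiv ℝ f q b) p a = _
    rw [fderiv_clm_apply hd (differentiableAt_const b)]
    simp
  rw [key, key]
  have hs : IsSymmSndFDerivAt ℝ f p :=
    hf.contDiffAt.isSymmSndFDerivAt (by simp; exact WithTop.coe_le_coe.2 le_top)
  exact hs v w

lemma DD_line (v p : V) {f : V → ℝ} (hf : ContDiff ℝ ∞ f) (t : ℝ) :
    HasDerivAt (fun s : ℝ => f (p + s • v)) (DD v f (p + t • v)) t := by
  have h1 : HasDerivAt (fun s : ℝ => p + s • v) v t := by
    simpa using ((hasDerivAt_id t).smul_const v).const_add p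
  exact (smooth_diff hf (p + t • v)).hasFDerivAt.comp_hasDerivAt t h1

lemma DD2_nonpos (v p : V) {f : V → ℝ} (hf : ContDiff ℝ ∞ f) (hm : IsLocalMax f p) :
    DD v (DD v f) p ≤ 0 := by
  by_contra hc
  push Not at hc
  set g : ℝ → ℝ := fun s => f (p + s • v) with hg
  have hd1 : deriv g = fun t => DD v f (p + t • v) := by
    funext t; exact (DD_line v p hf t).deriv
  have hd2 : deriv (deriv g) 0 = DD v (DD v f) p := by
    rw [hd1, (DD_line v p (DD_smooth v hf) 0).deriv]; simp
  have hcont : ContinuousAt (fun s : ℝ => p + s • v) 0 := by fun_prop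
  have hgm : IsLocalMax g 0 := by
    have : Filter.Tendsto (fun s : ℝ => p + s • v) (𝓝 0) (𝓝 p) := by
      simpa [ContinuousAt] using hcont
    have := this.eventually hm
    filter_upwards [this] with s hs
    simpa [hg] using hs
  have hgmin : IsLocalMin g 0 := by
    apply isLocalMin_of_deriv_deriv_pos (by rw [hd2]; exact hc) hgm.deriv_eq_zero
    exact (DD_line v p hf 0).continuousAt
  have hev : g =ᶠ[𝓝 0] fun _ => g 0 := by
    filter_upwards [hgm, hgmin] with s h1 h2
    exact le_antisymm h1 h2
  have : deriv (deriv g) 0 = 0 := by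
    have h1 := hev.deriv
    rw [h1.deriv_eq]; simp
  linarith

abbrev EE (d : ℕ) := EuclideanSpace ℝ (Fin d)

noncomputable def lap {d : ℕ} (f : EE d × ℝ → ℝ) (p : EE d × ℝ) : ℝ :=
  (∑ i, pdx i (pdx i f) p) + pdy (pdy f) p

lemma pdx_eq {d : ℕ} (i : Fin d) (f : EE d × ℝ → ℝ) :
    pdx i f = DD (EuclideanSpace.single i 1, 0) f := rfl
lemma pdy_eq {d : ℕ} (f : EE d × ℝ → ℝ) : pdy f = DD (0, 1) f := rfl

lemma lap_sub {d : ℕ} {f g : EE d × ℝ → ℝ} (hf : ContDiff ℝ ∞ f) (hg : ContDiff ℝ ∞ g)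
    (p : EE d × ℝ) : lap (fun p => f p - g p) p = lap f p - lap g p := by
  simp only [lap, pdx_eq, pdy_eq]
  simp only [DD_sub _ hf hg, DD_sub _ (DD_smooth _ hf) (DD_smooth _ hg), Finset.sum_sub_distrib]
  ring

lemma lap_cmul {d : ℕ} {f : EE d × ℝ → ℝ} (c : ℝ) (hf : ContDiff ℝ ∞ f)
    (p : EE d × ℝ) : lap (fun p => c * f p) p = c * lap f p := by
  simp only [lap, pdx_eq, pdy_eq]
  simp only [DD_cmul _ c hf, DD_cmul _ c (DD_smooth _ hf), mul_add, Finset.mul_sum]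

lemma lap_const {d : ℕ} (c : ℝ) (p : EE d × ℝ) : lap (fun _ => c) p = 0 := by
  simp only [lap, pdx_eq, pdy_eq]
  simp only [DD_const]; simp

lemma lap_snd {d : ℕ} (p : EE d × ℝ) : lap (fun p : EE d × ℝ => p.2) p = 0 := by
  have : ∀ v : EE d × ℝ, DD v (fun p : EE d × ℝ => p.2) = fun _ => v.2 := by
    intro v; funext q
    simp only [DD]
    rw [fderiv_snd]; rfl
  simp only [lap, pdx_eq, pdy_eq, this, DD_const]; simp

lemma lap_smooth {d : ℕ} {f : EE d × ℝ → ℝ} (hf : ContDiff ℝ ∞ f) : ContDiff ℝ ∞ (lap f) := by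
  unfold lap
  simp only [pdx_eq, pdy_eq]
  exact (ContDiff.sum fun i _ => DD_smooth _ (DD_smooth _ hf)).add (DD_smooth _ (DD_smooth _ hf))

lemma DD_sum {ι : Type*} (s : Finset ι) (v : V) {f : ι → V → ℝ} (hf : ∀ i, ContDiff ℝ ∞ (f i)) :
    DD v (fun p => ∑ i ∈ s, f i p) = fun p => ∑ i ∈ s, DD v (f i) p := by
  funext p
  simp only [DD]
  rw [fderiv_fun_sum (fun i _ => smooth_diff (hf i) p)]
  simp

lemma lap_pdy {d : ℕ} {f : EE d × ℝ → ℝ} (hf : ContDiff ℝ ∞ f) (p : EE d × ℝ) :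
    lap (pdy f) p = pdy (lap f) p := by
  have : lap f = fun p => (∑ i, pdx i (pdx i f) p) + pdy (pdy f) p := rfl
  rw [this]
  simp only [lap, pdx_eq, pdy_eq]
  rw [DD_add _ (ContDiff.sum fun i _ => DD_smooth _ (DD_smooth _ hf)) (DD_smooth _ (DD_smooth _ hf)),
    DD_sum _ _ (fun i => DD_smooth _ (DD_smooth _ hf))]
  congr 1
  refine Finset.sum_congr rfl fun i _ => ?_
  rw [DD_comm (0,1) _ (DD_smooth _ hf), DD_comm (0,1) _ hf]

noncomputable def barr {d : ℕ} (h : EE d → ℝ) (k : ℝ) (p : EE d × ℝ) : ℝ :=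
  Real.exp (k * (h p.1 - p.2))

lemma L_smooth {d : ℕ} {h : EE d → ℝ} (hh : ContDiff ℝ ∞ h) :
    ContDiff ℝ ∞ (fun p : EE d × ℝ => h p.1 - p.2) :=
  (hh.comp contDiff_fst).sub contDiff_snd

lemma barr_smooth {d : ℕ} {h : EE d → ℝ} (hh : ContDiff ℝ ∞ h) (k : ℝ) :
    ContDiff ℝ ∞ (barr h k) :=
  Real.contDiff_exp.comp (contDiff_const.mul (L_smooth hh))

lemma DD_barr {d : ℕ} {h : EE d → ℝ} (hh : ContDiff ℝ ∞ h) (k : ℝ) (v : EE d × ℝ) :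
    DD v (barr h k) = fun p => barr h k p * (k * DD v (fun p : EE d × ℝ => h p.1 - p.2) p) := by
  have : barr h k = fun p : EE d × ℝ => Real.exp (k * (h p.1 - p.2)) := rfl
  rw [this, DD_exp v (contDiff_const.mul (L_smooth hh)), DD_cmul v k (L_smooth hh)]

lemma DD2_barr {d : ℕ} {h : EE d → ℝ} (hh : ContDiff ℝ ∞ h) (k : ℝ) (v p : EE d × ℝ) :
    DD v (DD v (barr h k)) p = barr h k p * (k * DD v (DD v (fun p : EE d × ℝ => h p.1 - p.2)) p
      + k ^ 2 * (DD v (fun p : EE d × ℝ => h p.1 - p.2) p) ^ 2) := by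
  have hL := DD_smooth v (L_smooth hh)
  rw [DD_barr hh, DD_mul v (barr_smooth hh k) (contDiff_const.mul hL), DD_cmul v k hL, DD_barr hh]
  ring

lemma DDy_L {d : ℕ} {h : EE d → ℝ} (hh : ContDiff ℝ ∞ h) (p : EE d × ℝ) :
    DD (0,1) (fun p : EE d × ℝ => h p.1 - p.2) p = -1 := by
  have h1 := DD_line (0,1) p (L_smooth hh) 0
  have h2 : HasDerivAt (fun s : ℝ => h (p + s • ((0:EE d),(1:ℝ))).1 - (p + s • ((0:EE d),(1:ℝ))).2) (-1) 0 := by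
    simpa using ((hasDerivAt_id (0:ℝ)).const_add p.2).const_sub (h p.1)
  simpa using h1.unique h2

lemma lap_barr_pos {d : ℕ} {h : EE d → ℝ} (hh : ContDiff ℝ ∞ h) {K : Set (EE d × ℝ)}
    (hK : IsCompact K) : ∃ k : ℝ, 0 < k ∧ ∀ p ∈ K, 0 < lap (barr h k) p := by
  obtain ⟨M, hM⟩ := hK.exists_bound_of_continuousOn (lap_smooth (L_smooth hh)).continuous.continuousOn
  refine ⟨|M| + 1, by positivity, fun p hp => ?_⟩
  set k := |M| + 1
  have hk : 0 < k := by positivity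
  have hb := hM p hp
  rw [Real.norm_eq_abs] at hb
  have e : lap (barr h k) p = barr h k p * (k * lap (fun p : EE d × ℝ => h p.1 - p.2) p + k^2 * (∑ i,
      (DD (EuclideanSpace.single i 1, 0) (fun p : EE d × ℝ => h p.1 - p.2) p)^2) + k^2) := by
    simp only [lap, pdx_eq, pdy_eq, DD2_barr hh, ← Finset.mul_sum, Finset.sum_add_distrib]
    rw [DDy_L hh p]
    ring
  rw [e]
  refine mul_pos (Real.exp_pos _) ?_
  have h1 : 0 ≤ k^2 * (∑ i,
      (DD (EuclideanSpace.single i 1, 0) (fun p : EE d × ℝ => h p.1 - p.2) p)^2) := by positivity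
  have h2 : 0 < lap (fun p : EE d × ℝ => h p.1 - p.2) p + k := by
    have := neg_abs_le (lap (fun p : EE d × ℝ => h p.1 - p.2) p)
    have := le_abs_self M
    have : k = |M| + 1 := rfl
    linarith
  have h3 := mul_pos hk h2
  nlinarith

def cube (d : ℕ) : Set (EE d) := {x | ∀ i, x i ∈ Set.Icc (0:ℝ) 1}

lemma cube_compact (d : ℕ) : IsCompact (cube d) := by
  have h1 : IsCompact (Set.pi Set.univ fun _ : Fin d => Set.Icc (0:ℝ) 1) :=
    isCompact_univ_pi fun _ => isCompact_Icc
  have h2 := h1.image (PiLp.continuous_toLp 2 (fun _ : Fin d => ℝ))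
  convert h2 using 1
  ext x
  simp only [cube, Set.mem_ofPred_eq, Set.mem_image, Set.mem_pi, Set.mem_univ, true_implies]
  constructor
  · intro hx
    exact ⟨x.ofLp, hx, rfl⟩
  · rintro ⟨y, hy, rfl⟩
    exact hy

lemma cube_rep {d : ℕ} (x : EE d) : ∃ k : Fin d → ℤ,
    x + (WithLp.equiv 2 (Fin d → ℝ)).symm (fun i => (k i : ℝ)) ∈ cube d := by
  refine ⟨fun i => -⌊x i⌋, fun i => ?_⟩
  have h1 := Int.floor_le (x i)
  have h2 := Int.lt_floor_add_one (x i)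
  simp
  constructor <;> linarith

def strip {d : ℕ} (h : EE d → ℝ) (S : ℝ) : Set (EE d × ℝ) :=
  (fun q : EE d × ℝ => (q.1, h q.1 - q.2)) '' (cube d ×ˢ Set.Icc 0 S)

lemma strip_compact {d : ℕ} {h : EE d → ℝ} (hh : Continuous h) (S : ℝ) : IsCompact (strip h S) :=
  ((cube_compact d).prod isCompact_Icc).image (by fun_prop)

lemma mem_strip {d : ℕ} {h : EE d → ℝ} {S : ℝ} {p : EE d × ℝ} :
    p ∈ strip h S ↔ p.1 ∈ cube d ∧ h p.1 - S ≤ p.2 ∧ p.2 ≤ h p.1 := by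
  constructor
  · rintro ⟨q, ⟨h1, h2, h3⟩, rfl⟩
    exact ⟨h1, by simp; linarith, by simp; linarith⟩
  · rintro ⟨h1, h2, h3⟩
    exact ⟨(p.1, h p.1 - p.2), ⟨h1, by simp; linarith, by simp; linarith⟩, by simp⟩

lemma max_strip {d : ℕ} {h : EE d → ℝ} (hh : Continuous h) (hper : ZPeriodic h) (S : ℝ)
    {f : EE d × ℝ → ℝ} (hf : ContDiff ℝ ∞ f) (hfp : ZPeriodicX f)
    (hlap : ∀ p ∈ strip h S, p.2 < h p.1 → 0 < lap f p)
    (hb1 : ∀ x, f (x, h x) ≤ 0) (hb2 : ∀ x ∈ cube d, f (x, h x - S) ≤ 0)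
    (x : EE d) (y : ℝ) (hy1 : h x - S ≤ y) (hy2 : y ≤ h x) : f (x, y) ≤ 0 := by
  have rep : ∀ x y, h x - S ≤ y → y ≤ h x → ∃ q ∈ strip h S, f q = f (x, y) := by
    intro x y h1 h2
    obtain ⟨k, hk⟩ := cube_rep x
    refine ⟨(_, y), mem_strip.2 ⟨hk, ?_, ?_⟩, hfp x y k⟩
    · simp only [hper x k]; exact h1
    · simp only [hper x k]; exact h2
  obtain ⟨q0, hq0, hq0e⟩ := rep x y hy1 hy2
  obtain ⟨p, hp, hmax⟩ := (strip_compact hh S).exists_isMaxOn ⟨q0, hq0⟩ hf.continuous.continuousOn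
  rw [← hq0e]
  refine le_trans (hmax hq0) ?_
  obtain ⟨hp1, hp2, hp3⟩ := mem_strip.1 hp
  rcases hp3.eq_or_lt with e | hlt
  · have := hb1 p.1
    rwa [← e] at this
  rcases hp2.eq_or_lt with e | hlt2
  · have := hb2 p.1 hp1
    rwa [e] at this
  exfalso
  have hloc : IsLocalMax f p := by
    have o1 : ∀ᶠ q : EE d × ℝ in 𝓝 p, q.2 < h q.1 :=
      (continuous_snd.continuousAt).eventually_lt (hh.comp continuous_fst).continuousAt hlt
    have o2 : ∀ᶠ q : EE d × ℝ in 𝓝 p, h q.1 - S < q.2 :=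
      ((hh.comp continuous_fst).sub continuous_const).continuousAt.eventually_lt
        (continuous_snd.continuousAt) hlt2
    filter_upwards [o1, o2] with q h1 h2
    obtain ⟨r, hr, hre⟩ := rep q.1 q.2 h2.le h1.le
    have := hmax hr
    simp only [Set.mem_ofPred_eq, hre] at this
    exact this
  have := hlap p hp hlt
  have h2 : lap f p ≤ 0 := by
    simp only [lap, pdx_eq, pdy_eq]
    have := Finset.sum_nonpos (s := Finset.univ) (fun (i : Fin d) _ =>
      DD2_nonpos (EuclideanSpace.single i 1, 0) p hf hloc)
    have := DD2_nonpos (0,1) p hf hloc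
    linarith
  linarith

lemma DD_per {d : ℕ} (v : EE d × ℝ) {f : EE d × ℝ → ℝ} (hfp : ZPeriodicX f) :
    ZPeriodicX (DD v f) := by
  intro x y k
  set w : EE d := (WithLp.equiv 2 (Fin d → ℝ)).symm (fun i => (k i : ℝ)) with hw
  have h1 : (fun q : EE d × ℝ => f (q + (w, 0))) = f := by
    funext q
    have := hfp q.1 q.2 k
    rw [← hw] at this
    rw [← this]
    congr 1
    ext <;> simp
  have h2 := fderiv_comp_add_right (𝕜 := ℝ) (f := f) (x := (x, y)) ((w, 0) : EE d × ℝ)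
  rw [h1] at h2
  simp only [DD]
  rw [h2]
  simp

lemma barr_per {d : ℕ} {h : EE d → ℝ} (hper : ZPeriodic h) (k : ℝ) : ZPeriodicX (barr h k) := by
  intro x y n
  simp only [barr]
  rw [hper x n]

lemma comb_per {d : ℕ} {f g : EE d × ℝ → ℝ} (hf : ZPeriodicX f) (hg : ZPeriodicX g) (a b : ℝ) :
    ZPeriodicX (fun p => a * (f p - b) - g p) := by
  intro x y n
  simp only [hf x y n, hg x y n]

lemma lap_comb {d : ℕ} {f g : EE d × ℝ → ℝ} (hf : ContDiff ℝ ∞ f) (hg : ContDiff ℝ ∞ g) (a b : ℝ)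
    (p : EE d × ℝ) : lap (fun p => a * (f p - b) - g p) p = a * lap f p - lap g p := by
  rw [lap_sub (contDiff_const.mul (hf.sub contDiff_const)) hg,
    lap_cmul a (hf.sub contDiff_const), lap_sub hf contDiff_const, lap_const]
  ring

end helpers

/-- Maximum principles for the pressure `Q = φ − y` (Proposition `Prop:p3.2`,
items (i) and (ii)): the Taylor coefficient `a(x) = −∂_yQ(x,h(x))` is positive,
`∂_yQ < 0` on the closure of the fluid domain `Ω = {y < h(x)}`, and
`inf_{closure Ω}(−∂_yQ) ≥ min{inf_x a(x), 1}`. -/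
theorem pressure_maximum_principles (d : ℕ) (hd : 1 ≤ d)
    (h : EuclideanSpace ℝ (Fin d) → ℝ)
    (hsm : ContDiff ℝ (⊤ : ℕ∞) h)
    (hper : ZPeriodic h)
    (φ : EuclideanSpace ℝ (Fin d) × ℝ → ℝ)
    (hφsm : ContDiff ℝ (⊤ : ℕ∞) φ)
    (hφper : ZPeriodicX φ)
    (hφharm : ∀ p : EuclideanSpace ℝ (Fin d) × ℝ, p.2 < h p.1 →
      (∑ i, pdx i (pdx i φ) p) + pdy (pdy φ) p = 0)
    (hφbd : ∀ x, φ (x, h x) = h x)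
    (hφdecay : ∀ n : ℕ, 0 < n → ∀ ε > 0, ∃ Y : ℝ,
      ∀ (x : EuclideanSpace ℝ (Fin d)) (y : ℝ), y ≤ Y →
        ‖iteratedFDeriv ℝ n φ (x, y)‖ ≤ ε) :
    (∀ x, 0 < -pdy (pressure φ) (x, h x))
    ∧ (∀ p ∈ closure {p : EuclideanSpace ℝ (Fin d) × ℝ | p.2 < h p.1},
        pdy (pressure φ) p < 0)
    ∧ (∀ p ∈ closure {p : EuclideanSpace ℝ (Fin d) × ℝ | p.2 < h p.1},
        min (⨅ x : EuclideanSpace ℝ (Fin d), -pdy (pressure φ) (x, h x)) 1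
          ≤ -pdy (pressure φ) p) := by
  have hh := hsm.continuous
  have hQs : ContDiff ℝ (⊤ : ℕ∞) (pressure φ) := hφsm.sub contDiff_snd
  have hQp : ZPeriodicX (pressure φ) := by
    intro x y k
    simp only [pressure]
    rw [hφper x y k]
  have hlapQ : ∀ p : EE d × ℝ, p.2 < h p.1 → lap (pressure φ) p = 0 := by
    intro p hp
    have h1 := lap_sub hφsm (contDiff_snd (E := EE d) (F := ℝ)) p
    rw [lap_snd] at h1
    have h2 : lap φ p = 0 := hφharm p hp
    have h3 : lap (pressure φ) p = lap φ p - 0 := h1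
    rw [h3, h2]; simp
  have hdy : ∀ p, pdy (pressure φ) p = pdy φ p - 1 := by
    intro p
    have h1 := congrFun (DD_sub ((0:EE d),(1:ℝ)) hφsm (contDiff_snd (E := EE d) (F := ℝ))) p
    have h2 : DD ((0:EE d),(1:ℝ)) (fun p : EE d × ℝ => p.2) p = 1 := by
      simp only [DD]; rw [fderiv_snd]; rfl
    have h3 : pdy (pressure φ) p = pdy φ p - DD ((0:EE d),(1:ℝ)) (fun p : EE d × ℝ => p.2) p := h1
    rw [h3, h2]
  have hdec : ∀ ε > 0, ∃ Y : ℝ, ∀ (x : EE d) (y : ℝ), y ≤ Y → |pdy φ (x, y)| ≤ ε := by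
    intro ε hε
    obtain ⟨Y, hY⟩ := hφdecay 1 one_pos ε hε
    refine ⟨Y, fun x y hy => ?_⟩
    have h1 := hY x y hy
    rw [norm_iteratedFDeriv_one] at h1
    have h2 := (fderiv ℝ φ (x, y)).le_opNorm ((0:EE d),(1:ℝ))
    have h3 : ‖((0:EE d),(1:ℝ))‖ = 1 := by simp [Prod.norm_def]
    rw [h3, mul_one] at h2
    exact h2.trans h1
  obtain ⟨H, hH⟩ := (cube_compact d).exists_bound_of_continuousOn hh.continuousOn
  -- the Taylor coefficient is bounded below
  have hTaylor : ∃ c > 0, ∀ x, c ≤ -pdy (pressure φ) (x, h x) := by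
    obtain ⟨Y, hY⟩ := hdec (1/2) (by norm_num)
    obtain ⟨C, hC⟩ := (cube_compact d).exists_bound_of_continuousOn
      (f := fun x => φ (x, Y)) (hφsm.continuous.comp (by fun_prop)).continuousOn
    obtain ⟨S, hS⟩ : ∃ S, S = 2 * |C| + |Y| + |H| + 2 := ⟨_, rfl⟩
    have a1 := abs_nonneg C
    have a2 := abs_nonneg Y
    have a3 := abs_nonneg H
    have a4 := le_abs_self C
    have a5 := le_abs_self Y
    have a6 := le_abs_self H
    have a7 := neg_abs_le Y
    have hSpos : 0 < S := by linarith
    have hdeep : ∀ x ∈ cube d, 1 ≤ pressure φ (x, h x - S) := by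
      intro x hx
      have b1 := abs_le.1 (hC x hx)
      have b2 := abs_le.1 (hH x hx)
      have hyY : h x - S ≤ Y := by linarith [b2.2]
      have hmv := Convex.norm_image_sub_le_of_norm_hasDerivWithin_le (f := fun s : ℝ => φ (x, s))
        (f' := fun s => pdy φ (x, s)) (C := 1/2) (s := Set.Iic Y) (x := h x - S) (y := Y)
        (fun s _ => by
          have := DD_line ((0:EE d),(1:ℝ)) (x, 0) hφsm s
          simp at this
          exact this.hasDerivWithinAt) (fun s hs => hY x s hs) (convex_Iic Y) hyY (le_refl Y)
      rw [Real.norm_eq_abs, Real.norm_eq_abs, abs_of_nonneg (sub_nonneg.2 hyY)] at hmv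
      have b3 := abs_le.1 hmv
      simp only [pressure]
      linarith [b1.1, b2.2, b3.2]
    obtain ⟨k, hk, hkK⟩ := lap_barr_pos hsm (strip_compact hh S)
    have he : 0 < Real.exp (k * S) - 1 := by
      have := Real.add_one_lt_exp (mul_pos hk hSpos).ne'
      have := mul_pos hk hSpos
      linarith
    obtain ⟨ε, hε⟩ : ∃ ε, ε = 1 / (Real.exp (k * S) - 1) := ⟨_, rfl⟩
    have hεp : 0 < ε := by rw [hε]; positivity
    have hbs := barr_smooth hsm k
    have hfs : ContDiff ℝ (⊤ : ℕ∞) (fun p => ε * (barr h k p - 1) - pressure φ p) :=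
      (contDiff_const.mul (hbs.sub contDiff_const)).sub hQs
    have hbd0 : ∀ x, ε * (barr h k (x, h x) - 1) - pressure φ (x, h x) = 0 := by
      intro x
      simp [barr, pressure, hφbd x]
    have hcmp := max_strip hh hper S hfs (comb_per (barr_per hper k) hQp ε 1)
      (by
        intro p hp hlt
        rw [lap_comb hbs hQs, hlapQ p hlt, sub_zero]
        exact mul_pos hεp (hkK p hp))
      (fun x => (hbd0 x).le)
      (by
        intro x hx
        have e1 : ε * (barr h k (x, h x - S) - 1) = 1 := by
          simp only [barr, sub_sub_cancel]
          rw [hε]; field_simp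
        simp only [e1]
        linarith [hdeep x hx])
    refine ⟨ε * k, mul_pos hεp hk, fun x => ?_⟩
    have hline := DD_line ((0:EE d),(1:ℝ)) (x, h x) hfs 0
    have ht := hline.tendsto_slope_zero_left
    have hge : 0 ≤ DD ((0:EE d),(1:ℝ)) (fun p => ε * (barr h k p - 1) - pressure φ p)
        ((x, h x) + (0:ℝ) • ((0:EE d),(1:ℝ))) := by
      refine ge_of_tendsto ht ?_
      have : Set.Ioo (-S) 0 ∈ nhdsWithin (0:ℝ) (Set.Iio 0) := Ioo_mem_nhdsLT (by linarith)
      filter_upwards [this] with t htm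
      have hq := hcmp x (h x + t) (by linarith [htm.1]) (by linarith [htm.2])
      have hz := hbd0 x
      simp only [zero_add, zero_smul, add_zero, smul_eq_mul, Prod.smul_mk, smul_zero, mul_one,
        Prod.mk_add_mk, hz, sub_zero]
      exact mul_nonneg_of_nonpos_of_nonpos (inv_nonpos.2 htm.2.le) hq
    rw [zero_smul, add_zero, DD_sub _ (contDiff_const.mul (hbs.sub contDiff_const)) hQs,
      DD_cmul _ ε (hbs.sub contDiff_const), DD_sub _ hbs contDiff_const, DD_const, DD_barr hsm] at hge
    simp only [DDy_L hsm] at hge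
    have e2 : barr h k (x, h x) = 1 := by simp [barr]
    simp only [e2] at hge
    rw [pdy_eq]
    linarith
  obtain ⟨c, hc, hca⟩ := hTaylor
  have hmin : ∀ p ∈ closure {p : EuclideanSpace ℝ (Fin d) × ℝ | p.2 < h p.1},
        min (⨅ x : EuclideanSpace ℝ (Fin d), -pdy (pressure φ) (x, h x)) 1
          ≤ -pdy (pressure φ) p := by
    intro p hp
    have hple : p.2 ≤ h p.1 :=
      closure_lt_subset_le continuous_snd (hh.comp continuous_fst) hp
    obtain ⟨m, hm⟩ : ∃ m, m = min (⨅ x : EuclideanSpace ℝ (Fin d), -pdy (pressure φ) (x, h x)) 1 :=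
      ⟨_, rfl⟩
    have hm1 : m ≤ 1 := hm ▸ min_le_right _ _
    have hma : ∀ x, m ≤ -pdy (pressure φ) (x, h x) := by
      intro x
      rw [hm]
      refine (min_le_left _ _).trans (ciInf_le ⟨c, ?_⟩ x)
      rintro _ ⟨z, rfl⟩
      exact hca z
    rw [← hm]
    refine le_of_forall_pos_le_add fun η hη => ?_
    obtain ⟨Y, hY⟩ := hdec (η/2) (by linarith)
    obtain ⟨S, hS⟩ : ∃ S, S = |Y| + |H| + (h p.1 - p.2) := ⟨_, rfl⟩
    have a2 := abs_nonneg Y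
    have a3 := abs_nonneg H
    have a6 := le_abs_self H
    have a7 := neg_abs_le Y
    obtain ⟨k, hk, hkK⟩ := lap_barr_pos hsm (strip_compact hh S)
    obtain ⟨δ, hδ⟩ : ∃ δ, δ = (η/2) / Real.exp (k * S) := ⟨_, rfl⟩
    have hδp : 0 < δ := by rw [hδ]; positivity
    have hδe : δ * Real.exp (k * S) = η/2 := by rw [hδ]; field_simp
    have hbs := barr_smooth hsm k
    have hds : ContDiff ℝ (⊤ : ℕ∞) (pdy φ) := DD_smooth _ hφsm
    -- `g = (1 - m + η/2 ...)`: we compare with `v = 1 - ∂_y φ`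
    obtain ⟨v, hv⟩ : ∃ v : EE d × ℝ → ℝ, v = fun q => (1 - m + η/2) - pdy φ q := ⟨_, rfl⟩
    have hvs : ContDiff ℝ (⊤ : ℕ∞) v := by rw [hv]; exact contDiff_const.sub hds
    have hvp : ZPeriodicX v := by
      intro x y n
      have := DD_per ((0:EE d),(1:ℝ)) hφper x y n
      rw [← pdy_eq] at this
      simp only [hv]
      rw [this]
    have hvl : ∀ q : EE d × ℝ, q.2 < h q.1 → lap v q = 0 := by
      intro q hq
      rw [hv, lap_sub contDiff_const hds, lap_const, lap_pdy hφsm]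
      have hev : lap φ =ᶠ[nhds q] fun _ => 0 := by
        filter_upwards [(isOpen_lt continuous_snd (hh.comp continuous_fst)).mem_nhds hq] with r hr
        exact hφharm r hr
      simp only [pdy]
      rw [hev.fderiv_eq]
      simp
    have hS0 : ∀ x y, h x - S ≤ y → barr h k (x, y) ≤ Real.exp (k * S) := by
      intro x y hy
      simp only [barr]
      gcongr
      linarith
    have hcmp := max_strip hh hper S
      (f := fun q => δ * (barr h k q - Real.exp (k * S)) - v q)
      ((contDiff_const.mul (hbs.sub contDiff_const)).sub hvs)
      (comb_per (barr_per hper k) hvp δ (Real.exp (k * S)))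
      (by
        intro q hq hlt
        rw [lap_comb hbs hvs, hvl q hlt, sub_zero]
        exact mul_pos hδp (hkK q hq))
      (by
        intro x
        have h1 := hS0 x (h x) (by linarith)
        have h2 := mul_nonneg hδp.le (sub_nonneg.2 h1)
        have h3 := hma x
        rw [hdy] at h3
        simp only [hv]
        linarith)
      (by
        intro x hx
        have h1 := hS0 x (h x - S) le_rfl
        have h2 := mul_nonneg hδp.le (sub_nonneg.2 h1)
        have b2 := abs_le.1 (hH x hx)
        have h3 := abs_le.1 (hY x (h x - S) (by linarith [b2.2]))
        simp only [hv]
        linarith [h3.2])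
      p.1 p.2 (by linarith) hple
    have hbp : 0 < barr h k (p.1, p.2) := Real.exp_pos _
    have h2 := mul_pos hδp hbp
    rw [hdy]
    simp only [hv] at hcmp
    have h4 : pdy φ (p.1, p.2) = pdy φ p := rfl
    rw [h4] at hcmp
    linarith
  refine ⟨fun x => hc.trans_le (hca x), fun p hp => ?_, hmin⟩
  have h1 := hmin p hp
  have h2 : 0 < min (⨅ x : EuclideanSpace ℝ (Fin d), -pdy (pressure φ) (x, h x)) 1 :=
    lt_min (hc.trans_le (le_ciInf hca)) one_pos
  linarith
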